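/- Define kernels D_{i,j} := G'_i * G̃'_j where G_k(t,x) = (t^k/k!)∂_x^{2k}G(t,x), G'_k = ∂_x G_k, and tilde denotes reflection F̃(z) = F(-z). Then for i, j ≥ 1 the recursion D_{i,j} = -(1/2)(D_{i-1,j} + D_{i,j-1}) holds. -/

import Mathlib

open MeasureTheory Real

/-- The 1d heat kernel, extended by zero for nonpositive times. -/
noncomputable def heatK (t x : ℝ) : ℝ :=
  if 0 < t then (Real.sqrt (4 * Real.pi * t))⁻¹ * Real.exp (-x ^ 2 / (4 * t)) else 0

/-- Space-time convolution `(F * H)(t,x) = ∫∫ F(t-s, x-y) H(s,y) dy ds`. -/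
noncomputable def stConv (F H : ℝ → ℝ → ℝ) : ℝ → ℝ → ℝ :=
  fun t x => ∫ p : ℝ × ℝ, F (t - p.1) (x - p.2) * H p.1 p.2

/-- `G_k(t,x) = (t^k/k!) ∂_x^{2k} G(t,x)`. -/
noncomputable def Gk (k : ℕ) (t x : ℝ) : ℝ :=
  t ^ k / (Nat.factorial k) * iteratedDeriv (2 * k) (fun y => heatK t y) x

/-- `G'_k = ∂_x G_k`. -/
noncomputable def Gk' (k : ℕ) (t x : ℝ) : ℝ := deriv (fun y => Gk k t y) x

/-- Reflection `F̃(t,x) = F(-t,-x)`. -/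
def reflK (F : ℝ → ℝ → ℝ) : ℝ → ℝ → ℝ := fun t x => F (-t) (-x)

/-- `D_{i,j} := G'_i * G̃'_j` (space-time convolution). -/
noncomputable def Dker (i j : ℕ) : ℝ → ℝ → ℝ := stConv (Gk' i) (reflK (Gk' j))

open Filter Topology Set

lemma contDiff_exp_neg_sq_div_two {n : WithTop ℕ∞} :
    ContDiff ℝ n (fun y : ℝ => Real.exp (-(y ^ 2 / 2))) := by
  fun_prop

/-- The `n`-th derivative of the Gaussian `exp (-y² / 2)`. -/
noncomputable def gaussDeriv (n : ℕ) : ℝ → ℝ :=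
  iteratedDeriv n (fun y : ℝ => Real.exp (-(y ^ 2 / 2)))

lemma hasDerivAt_gaussDeriv (n : ℕ) (z : ℝ) :
    HasDerivAt (gaussDeriv n) (gaussDeriv (n + 1) z) z := by
  have h : Differentiable ℝ (gaussDeriv n) :=
    contDiff_exp_neg_sq_div_two.differentiable_iteratedDeriv (n := (n + 1 : ℕ)) n
      (by exact_mod_cast n.lt_succ_self)
  have := (h z).hasDerivAt
  rwa [gaussDeriv, ← iteratedDeriv_succ] at this

lemma continuous_gaussDeriv (n : ℕ) : Continuous (gaussDeriv n) :=
  continuous_iff_continuousAt.2 fun z => (hasDerivAt_gaussDeriv n z).continuousAt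

lemma gaussDeriv_zero (z : ℝ) : gaussDeriv 0 z = Real.exp (-(z ^ 2 / 2)) := by
  simp [gaussDeriv]

lemma gaussDeriv_one (z : ℝ) : gaussDeriv 1 z = -z * gaussDeriv 0 z := by
  refine (hasDerivAt_gaussDeriv 0 z).unique ?_
  have h : HasDerivAt (fun y : ℝ => Real.exp (-(y ^ 2 / 2)))
      (Real.exp (-(z ^ 2 / 2)) * (-z)) z := by
    refine HasDerivAt.exp ?_
    exact ((hasDerivAt_pow 2 z).div_const 2).fun_neg.congr_deriv (by simp)
  rw [gaussDeriv_zero, show gaussDeriv 0 = fun y => _ from funext gaussDeriv_zero]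
  exact h.congr_deriv (mul_comm _ _)

lemma gaussDeriv_add_two (n : ℕ) (z : ℝ) :
    gaussDeriv (n + 2) z = -z * gaussDeriv (n + 1) z - (n + 1) * gaussDeriv n z := by
  induction n generalizing z with
  | zero =>
    refine (hasDerivAt_gaussDeriv 1 z).unique ?_
    rw [show gaussDeriv 1 = fun z => -z * gaussDeriv 0 z from funext gaussDeriv_one]
    refine ((hasDerivAt_id z).fun_neg.fun_mul (hasDerivAt_gaussDeriv 0 z)).congr_deriv ?_
    simp [gaussDeriv_one]
    ring
  | succ n ih =>
    refine (hasDerivAt_gaussDeriv (n + 2) z).unique ?_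
    rw [show gaussDeriv (n + 2) = fun z => _ from funext ih]
    refine (((hasDerivAt_id z).fun_neg.fun_mul (hasDerivAt_gaussDeriv (n + 1) z)).fun_sub
      ((hasDerivAt_gaussDeriv n z).const_mul ((n : ℝ) + 1))).congr_deriv ?_
    simp [ih]
    ring

lemma abs_pow_le_mul_exp (n : ℕ) :
    ∃ C : ℝ, ∀ z : ℝ, |z| ^ n ≤ C * Real.exp (z ^ 2 / 4) := by
  refine ⟨1 + 4 ^ n * n.factorial, fun z => ?_⟩
  have h0 : (1 : ℝ) ≤ Real.exp (z ^ 2 / 4) := Real.one_le_exp (by positivity)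
  have h1 : (z ^ 2 / 4) ^ n / n.factorial ≤ Real.exp (z ^ 2 / 4) :=
    Real.pow_div_factorial_le_exp _ (by positivity) n
  rw [div_le_iff₀ (by positivity), div_pow, div_le_iff₀ (by positivity)] at h1
  have h2 : |z| ^ n ≤ 1 + (z ^ 2) ^ n := by
    have : (z ^ 2) ^ n = (|z| ^ n) ^ 2 := by rw [← sq_abs, ← pow_mul, ← pow_mul, mul_comm]
    rw [this]
    nlinarith [sq_nonneg (|z| ^ n - 1), sq_nonneg (|z| ^ n)]
  nlinarith

lemma Polynomial.abs_eval_le_mul_exp (p : Polynomial ℝ) :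
    ∃ C : ℝ, ∀ z : ℝ, |p.eval z| ≤ C * Real.exp (z ^ 2 / 4) := by
  induction p using Polynomial.induction_on' with
  | add p q hp hq =>
    obtain ⟨C, hC⟩ := hp
    obtain ⟨D, hD⟩ := hq
    refine ⟨C + D, fun z => ?_⟩
    rw [Polynomial.eval_add, add_mul]
    exact (abs_add_le _ _).trans (add_le_add (hC z) (hD z))
  | monomial n a =>
    obtain ⟨C, hC⟩ := abs_pow_le_mul_exp n
    refine ⟨|a| * C, fun z => ?_⟩
    rw [Polynomial.eval_monomial, abs_mul, abs_pow, mul_assoc]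
    exact mul_le_mul_of_nonneg_left (hC z) (abs_nonneg a)

lemma abs_gaussDeriv_le (n : ℕ) :
    ∃ C : ℝ, 0 ≤ C ∧ ∀ z : ℝ, |gaussDeriv n z| ≤ C * Real.exp (-(z ^ 2 / 4)) := by
  obtain ⟨C, hC⟩ :=
    ((Polynomial.hermite n).map (algebraMap ℤ ℝ)).abs_eval_le_mul_exp
  have hC0 : 0 ≤ C := by simpa using (abs_nonneg _).trans (hC 0)
  refine ⟨C, hC0, fun z => ?_⟩
  rw [gaussDeriv, iteratedDeriv_eq_iterate, Polynomial.deriv_gaussian_eq_hermite_mul_gaussian,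
    abs_mul, abs_mul, abs_pow, abs_neg, abs_one, one_pow, one_mul, abs_of_pos (Real.exp_pos _),
    Polynomial.aeval_def, ← Polynomial.eval_map]
  calc _ ≤ C * Real.exp (z ^ 2 / 4) * Real.exp (-(z ^ 2 / 2)) :=
        mul_le_mul_of_nonneg_right (hC z) (Real.exp_pos _).le
    _ = C * Real.exp (-(z ^ 2 / 4)) := by
        rw [mul_assoc, ← Real.exp_add]; ring_nf

/-- The `n`-th spatial derivative of the heat kernel. -/
noncomputable def heatDeriv (n : ℕ) (t x : ℝ) : ℝ := iteratedDeriv n (heatK t) x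

lemma heatK_eq {t : ℝ} (ht : 0 < t) (x : ℝ) :
    heatK t x = (√(2 * π))⁻¹ * (√(2 * t))⁻¹ * Real.exp (-(((√(2 * t))⁻¹ * x) ^ 2 / 2)) := by
  have h2 : √(4 * π * t) = √(2 * π) * √(2 * t) := by
    rw [← Real.sqrt_mul (by positivity)]; ring_nf
  rw [heatK, if_pos ht, h2, mul_inv, mul_pow, inv_pow, Real.sq_sqrt (by positivity)]
  congr 2
  field_simp
  ring

lemma heatDeriv_eq (n : ℕ) {t : ℝ} (ht : 0 < t) (x : ℝ) :
    heatDeriv n t x =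
      (√(2 * π))⁻¹ * (√(2 * t))⁻¹ ^ (n + 1) * gaussDeriv n ((√(2 * t))⁻¹ * x) := by
  rw [heatDeriv, show heatK t = fun x => _ from funext (heatK_eq ht),
    iteratedDeriv_const_mul_field,
    iteratedDeriv_comp_const_mul (f := fun y : ℝ => Real.exp (-(y ^ 2 / 2)))
      contDiff_exp_neg_sq_div_two, gaussDeriv]
  ring

lemma heatDeriv_of_nonpos (n : ℕ) {t : ℝ} (ht : t ≤ 0) (x : ℝ) : heatDeriv n t x = 0 := by
  have : heatK t = fun _ => 0 := by funext y; simp [heatK, ht.not_gt]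
  rw [heatDeriv, this]
  simp

lemma heatDeriv_zero (t x : ℝ) : heatDeriv 0 t x = heatK t x := by simp [heatDeriv]

lemma heatK_nonneg (t x : ℝ) : 0 ≤ heatK t x := by
  rw [heatK]; split_ifs <;> positivity

lemma hasDerivAt_heatDeriv_space (n : ℕ) (t x : ℝ) :
    HasDerivAt (heatDeriv n t) (heatDeriv (n + 1) t x) x := by
  rcases le_or_gt t 0 with ht | ht
  · rw [heatDeriv_of_nonpos _ ht, show heatDeriv n t = fun _ => 0 from
      funext (heatDeriv_of_nonpos n ht)]
    exact hasDerivAt_const _ _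
  · rw [heatDeriv_eq _ ht, show heatDeriv n t = fun x => _ from funext (heatDeriv_eq n ht)]
    have h1 : HasDerivAt (fun x => (√(2 * t))⁻¹ * x) (√(2 * t))⁻¹ x := by
      simpa using (hasDerivAt_id x).const_mul (√(2 * t))⁻¹
    exact (((hasDerivAt_gaussDeriv n _).comp x h1).const_mul
      ((√(2 * π))⁻¹ * (√(2 * t))⁻¹ ^ (n + 1))).congr_deriv (by ring)

lemma continuous_heatDeriv (n : ℕ) (t : ℝ) : Continuous (heatDeriv n t) :=
  continuous_iff_continuousAt.2 fun x => (hasDerivAt_heatDeriv_space n t x).continuousAt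

lemma hasDerivAt_heatDeriv_time (n : ℕ) {t : ℝ} (ht : 0 < t) (x : ℝ) :
    HasDerivAt (fun t => heatDeriv n t x) (heatDeriv (n + 2) t x) t := by
  have hq : 0 < √(2 * t) := by positivity
  have h0 : HasDerivAt (fun t : ℝ => √(2 * t)) (√(2 * t))⁻¹ t := by
    have : HasDerivAt (fun t : ℝ => 2 * t) 2 t := by simpa using (hasDerivAt_id t).const_mul 2
    convert this.sqrt (by positivity) using 1
    field_simp
  have h1 := h0.fun_inv hq.ne'
  have h2 := (h1.fun_pow (n + 1)).const_mul (√(2 * π))⁻¹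
  have h3 := (hasDerivAt_gaussDeriv n _).comp t (h1.mul_const x)
  have h4 := h2.fun_mul h3
  have h5 : (fun t => heatDeriv n t x) =ᶠ[𝓝 t] _ :=
    (eventually_gt_nhds ht).mono fun s hs => heatDeriv_eq n hs x
  refine HasDerivAt.congr_of_eventuallyEq ?_ h5
  refine h4.congr_deriv ?_
  rw [heatDeriv_eq _ ht, gaussDeriv_add_two]
  simp only [Function.comp_apply, Nat.add_sub_cancel]
  push_cast
  generalize gaussDeriv (n + 1) _ = A
  generalize gaussDeriv n _ = B
  have hq' := hq.ne'
  generalize √(2 * t) = q at hq' ⊢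
  simp only [inv_pow]
  field_simp
  ring

lemma measurable_heatDeriv (n : ℕ) : Measurable (fun p : ℝ × ℝ => heatDeriv n p.1 p.2) := by
  have : (fun p : ℝ × ℝ => heatDeriv n p.1 p.2) = fun p => if 0 < p.1 then
      (√(2 * π))⁻¹ * (√(2 * p.1))⁻¹ ^ (n + 1) * gaussDeriv n ((√(2 * p.1))⁻¹ * p.2) else 0 := by
    funext p
    split_ifs with h
    · exact heatDeriv_eq n h p.2
    · exact heatDeriv_of_nonpos n (not_lt.1 h) p.2
  rw [this]
  refine Measurable.ite (measurableSet_lt measurable_const measurable_fst) ?_ measurable_const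
  have := (continuous_gaussDeriv n).measurable
  fun_prop

lemma abs_heatDeriv_le (n : ℕ) : ∃ C : ℝ, 0 ≤ C ∧ ∀ t : ℝ, 0 < t → ∀ x : ℝ,
    |heatDeriv n t x| ≤ C * (√t)⁻¹ ^ n * heatK (2 * t) x := by
  obtain ⟨C, hC0, hC⟩ := abs_gaussDeriv_le n
  refine ⟨C * √2, by positivity, fun t ht x => ?_⟩
  rw [heatDeriv_eq n ht, heatK_eq (by positivity), abs_mul, abs_of_pos (by positivity)]
  have h1 : √(2 * (2 * t)) = √2 * √(2 * t) := by rw [← Real.sqrt_mul (by positivity)]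
  have h2 : (√(2 * t))⁻¹ ≤ (√t)⁻¹ := by
    gcongr
    linarith
  have h3 : ((√(2 * (2 * t)))⁻¹ * x) ^ 2 / 2 = ((√(2 * t))⁻¹ * x) ^ 2 / 4 := by
    rw [h1, mul_inv, mul_assoc, mul_pow, inv_pow, Real.sq_sqrt (by positivity)]
    ring
  rw [h3]
  calc _ ≤ (√(2 * π))⁻¹ * (√(2 * t))⁻¹ ^ (n + 1) *
        (C * Real.exp (-(((√(2 * t))⁻¹ * x) ^ 2 / 4))) := by gcongr; exact hC _
    _ = (√(2 * π))⁻¹ * ((√(2 * t))⁻¹ ^ n * (√(2 * t))⁻¹) *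
        (C * Real.exp (-(((√(2 * t))⁻¹ * x) ^ 2 / 4))) := by rw [pow_succ]
    _ ≤ (√(2 * π))⁻¹ * ((√t)⁻¹ ^ n * (√(2 * t))⁻¹) *
        (C * Real.exp (-(((√(2 * t))⁻¹ * x) ^ 2 / 4))) := by gcongr
    _ = _ := by
      rw [h1]
      field_simp

lemma Gk'_eq (k : ℕ) (t x : ℝ) :
    Gk' k t x = t ^ k / k.factorial * heatDeriv (2 * k + 1) t x :=
  ((hasDerivAt_heatDeriv_space (2 * k) t x).const_mul (t ^ k / (k.factorial : ℝ))).deriv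

lemma Gk'_of_nonpos (k : ℕ) {t : ℝ} (ht : t ≤ 0) (x : ℝ) : Gk' k t x = 0 := by
  rw [Gk'_eq, heatDeriv_of_nonpos _ ht, mul_zero]

lemma measurable_Gk' (k : ℕ) : Measurable (fun p : ℝ × ℝ => Gk' k p.1 p.2) := by
  simp only [Gk'_eq]
  have := measurable_heatDeriv (2 * k + 1)
  fun_prop

lemma abs_Gk'_le (k : ℕ) : ∃ C : ℝ, 0 ≤ C ∧ ∀ t : ℝ, 0 < t → ∀ x : ℝ,
    |Gk' k t x| ≤ C * (√t)⁻¹ * heatK (2 * t) x := by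
  obtain ⟨C, hC0, hC⟩ := abs_heatDeriv_le (2 * k + 1)
  refine ⟨C, hC0, fun t ht x => ?_⟩
  have h1 : (1 : ℝ) ≤ k.factorial := by exact_mod_cast k.factorial_pos
  have h2 : t ^ k / k.factorial ≤ t ^ k := div_le_self (by positivity) h1
  rw [Gk'_eq, abs_mul, abs_of_nonneg (by positivity)]
  calc _ ≤ t ^ k * (C * (√t)⁻¹ ^ (2 * k + 1) * heatK (2 * t) x) := by
        gcongr; exact hC t ht x
    _ = C * (√t)⁻¹ * heatK (2 * t) x := by
      rw [pow_succ, pow_mul, inv_pow (√t) 2, Real.sq_sqrt ht.le, inv_pow]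
      field_simp

lemma Gk'_scale (k : ℕ) (t x : ℝ) : Gk' k (4 * t) (2 * x) = Gk' k t x / 4 := by
  rcases le_or_gt t 0 with ht | ht
  · rw [Gk'_of_nonpos _ ht, Gk'_of_nonpos _ (by linarith), zero_div]
  · have h1 : √(2 * (4 * t)) = 2 * √(2 * t) := by
      rw [show 2 * (4 * t) = 2 ^ 2 * (2 * t) by ring, Real.sqrt_mul (by positivity),
        Real.sqrt_sq (by norm_num)]
    have h2 : (2 * √(2 * t))⁻¹ * (2 * x) = (√(2 * t))⁻¹ * x := by field_simp
    rw [Gk'_eq, Gk'_eq, heatDeriv_eq _ ht, heatDeriv_eq _ (by positivity), h1, h2, mul_inv,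
      mul_pow, mul_pow, show 2 * k + 1 + 1 = 2 * (k + 1) by ring, pow_mul (2 : ℝ)⁻¹, pow_succ _ k,
      show (2 : ℝ)⁻¹ ^ 2 = 4⁻¹ by norm_num, inv_pow]
    field_simp

lemma integrable_heatK (t : ℝ) : Integrable (heatK t) := by
  rcases le_or_gt t 0 with ht | ht
  · have : heatK t = fun _ => 0 := by funext y; simp [heatK, ht.not_gt]
    rw [this]
    exact integrable_zero _ _ _
  · have h := (integrable_exp_neg_mul_sq (b := 1 / (4 * t)) (by positivity)).const_mul
      (√(4 * π * t))⁻¹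
    refine h.congr (Eventually.of_forall fun y => ?_)
    simp only [heatK, if_pos ht]
    congr 2
    field_simp

lemma integrable_heatDeriv (n : ℕ) (t : ℝ) : Integrable (heatDeriv n t) := by
  rcases le_or_gt t 0 with ht | ht
  · rw [show heatDeriv n t = fun _ => 0 from funext (heatDeriv_of_nonpos n ht)]
    exact integrable_zero _ _ _
  · obtain ⟨C, -, hC⟩ := abs_heatDeriv_le n
    exact ((integrable_heatK (2 * t)).const_mul (C * (√t)⁻¹ ^ n)).mono'
      (continuous_heatDeriv n t).aestronglyMeasurable (Eventually.of_forall (hC t ht))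

lemma heatK_le {t : ℝ} (ht : 0 < t) (x : ℝ) : heatK t x ≤ (√(4 * π * t))⁻¹ := by
  rw [heatK, if_pos ht]
  refine mul_le_of_le_one_right (by positivity) (Real.exp_le_one_iff.2 ?_)
  exact div_nonpos_of_nonpos_of_nonneg (by nlinarith [sq_nonneg x]) (by positivity)

lemma exists_abs_heatDeriv_le (n : ℕ) (t : ℝ) : ∃ C : ℝ, ∀ x, |heatDeriv n t x| ≤ C := by
  rcases le_or_gt t 0 with ht | ht
  · exact ⟨0, fun x => by simp [heatDeriv_of_nonpos n ht]⟩
  · obtain ⟨C, hC0, hC⟩ := abs_heatDeriv_le n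
    exact ⟨C * (√t)⁻¹ ^ n * (√(4 * π * (2 * t)))⁻¹, fun x => (hC t ht x).trans <| by
      gcongr; exact heatK_le (by positivity) x⟩

lemma integrable_heatDeriv_mul (a b : ℕ) (τ s x : ℝ) :
    Integrable (fun y => heatDeriv a τ (x + y) * heatDeriv b s y) := by
  obtain ⟨C, hC⟩ := exists_abs_heatDeriv_le a τ
  exact (integrable_heatDeriv b s).bdd_mul (c := C)
    ((continuous_heatDeriv a τ).comp (continuous_const.add continuous_id)).aestronglyMeasurable
    (Eventually.of_forall fun y => hC _)

lemma integral_heatK_mul_heatK {τ s : ℝ} (hτ : 0 < τ) (hs : 0 < s) (x : ℝ) :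
    ∫ y, heatK τ (x + y) * heatK s y = heatK (τ + s) x := by
  have hts : 0 < τ + s := by positivity
  set b : ℝ := (τ + s) / (4 * τ * s) with hb
  have hb0 : 0 < b := by positivity
  have h1 : ∀ y, heatK τ (x + y) * heatK s y =
      ((√(4 * π * τ))⁻¹ * (√(4 * π * s))⁻¹ * Real.exp (-x ^ 2 / (4 * (τ + s)))) *
        Real.exp (-b * (y + x * s / (τ + s)) ^ 2) := by
    intro y
    rw [heatK, heatK, if_pos hτ, if_pos hs]
    have : -(x + y) ^ 2 / (4 * τ) + -y ^ 2 / (4 * s) =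
        -x ^ 2 / (4 * (τ + s)) + -b * (y + x * s / (τ + s)) ^ 2 := by
      rw [hb]
      field_simp
      ring
    calc _ = (√(4 * π * τ))⁻¹ * (√(4 * π * s))⁻¹ *
          (Real.exp (-(x + y) ^ 2 / (4 * τ)) * Real.exp (-y ^ 2 / (4 * s))) := by ring
      _ = _ := by rw [← Real.exp_add, this, Real.exp_add]; ring
  simp_rw [h1]
  rw [integral_const_mul,
    integral_add_right_eq_self (fun y => Real.exp (-b * y ^ 2)) (x * s / (τ + s)),
    integral_gaussian, heatK, if_pos hts]
  have h2 : √(π / b) = √(4 * π * τ) * √(4 * π * s) * (√(4 * π * (τ + s)))⁻¹ := by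
    rw [← Real.sqrt_mul (by positivity), ← Real.sqrt_inv, ← Real.sqrt_mul (by positivity), hb]
    congr 1
    field_simp
  have h3 : 0 < √(4 * π * τ) := by positivity
  have h4 : 0 < √(4 * π * s) := by positivity
  rw [h2]
  generalize √(4 * π * τ) = A at *
  generalize √(4 * π * s) = B at *
  field_simp

lemma integral_heatDeriv_mul_heatK (a : ℕ) {τ s : ℝ} (hτ : 0 < τ) (hs : 0 < s) (x : ℝ) :
    ∫ y, heatDeriv a τ (x + y) * heatDeriv 0 s y = heatDeriv a (τ + s) x := by
  induction a generalizing x with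
  | zero =>
    simp only [heatDeriv_zero]
    exact integral_heatK_mul_heatK hτ hs x
  | succ a ih =>
    obtain ⟨C, hC⟩ := exists_abs_heatDeriv_le (a + 1) τ
    have h := (hasDerivAt_integral_of_dominated_loc_of_deriv_le (μ := volume) (x₀ := x)
      (s := univ) (F := fun x y => heatDeriv a τ (x + y) * heatDeriv 0 s y)
      (F' := fun x y => heatDeriv (a + 1) τ (x + y) * heatDeriv 0 s y)
      (bound := fun y => C * |heatDeriv 0 s y|) univ_mem
      (Eventually.of_forall fun z => (integrable_heatDeriv_mul a 0 τ s z).aestronglyMeasurable)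
      (integrable_heatDeriv_mul a 0 τ s x)
      (integrable_heatDeriv_mul (a + 1) 0 τ s x).aestronglyMeasurable
      (Eventually.of_forall fun y z _ => by
        rw [Real.norm_eq_abs, abs_mul]
        exact mul_le_mul_of_nonneg_right (hC _) (abs_nonneg _))
      ((integrable_heatDeriv 0 s).abs.const_mul C)
      (Eventually.of_forall fun y z _ =>
        ((hasDerivAt_heatDeriv_space a τ (z + y)).comp_add_const z y).mul_const _)).2
    simp_rw [ih] at h
    exact h.unique (hasDerivAt_heatDeriv_space a (τ + s) x)

lemma integral_heatDeriv_mul_heatDeriv (a b : ℕ) {τ s : ℝ} (hτ : 0 < τ) (hs : 0 < s) (x : ℝ) :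
    ∫ y, heatDeriv a τ (x + y) * heatDeriv b s y = (-1) ^ b * heatDeriv (a + b) (τ + s) x := by
  induction b generalizing a with
  | zero => simpa using integral_heatDeriv_mul_heatK a hτ hs x
  | succ b ih =>
    rw [integral_mul_deriv_eq_deriv_mul_of_integrable
      (u := fun y => heatDeriv a τ (x + y)) (v := heatDeriv b s)
      (u' := fun y => heatDeriv (a + 1) τ (x + y)) (v' := heatDeriv (b + 1) s)
      (fun y _ => (hasDerivAt_heatDeriv_space a τ (x + y)).comp_const_add x y)
      (fun y _ => hasDerivAt_heatDeriv_space b s y)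
      (integrable_heatDeriv_mul a (b + 1) τ s x) (integrable_heatDeriv_mul (a + 1) b τ s x)
      (integrable_heatDeriv_mul a b τ s x), ih, pow_succ]
    rw [show a + 1 + b = a + (b + 1) by ring]
    ring

lemma Dker_eq_integral (i j : ℕ) (t x : ℝ) :
    Dker i j t x = ∫ p : ℝ × ℝ, Gk' i (t + p.1) (x + p.2) * Gk' j p.1 p.2 := by
  rw [Dker, stConv, ← integral_neg_eq_self]
  simp [reflK]

lemma Dker_zero_zero (i j : ℕ) : Dker i j 0 0 = 0 := by
  rw [Dker_eq_integral]
  set f : ℝ × ℝ → ℝ := fun p => Gk' i p.1 p.2 * Gk' j p.1 p.2 with hf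
  have hf_meas : Measurable f := (measurable_Gk' i).mul (measurable_Gk' j)
  have hmap : Measure.map (Prod.map (4 * ·) (2 * ·)) (volume : Measure (ℝ × ℝ)) =
      ENNReal.ofReal (1 / 8) • volume := by
    rw [Measure.volume_eq_prod, ← Measure.map_prod_map _ _ (by fun_prop) (by fun_prop),
      Real.map_volume_mul_left (by norm_num), Real.map_volume_mul_left (by norm_num),
      Measure.prod_smul_left, Measure.prod_smul_right, smul_smul,
      ← ENNReal.ofReal_mul (by positivity)]
    norm_num [abs_of_pos]
  have h1 : ∫ p, f (Prod.map (4 * ·) (2 * ·) p) = 1 / 8 * ∫ p, f p := by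
    rw [← integral_map (by fun_prop) hf_meas.aestronglyMeasurable, hmap, integral_smul_measure,
      ENNReal.toReal_ofReal (by norm_num), smul_eq_mul]
  have h2 : ∀ p, f (Prod.map (4 * ·) (2 * ·) p) = 1 / 16 * f p := by
    intro p
    simp only [hf, Prod.map_fst, Prod.map_snd, Gk'_scale]
    ring
  simp_rw [h2, integral_const_mul] at h1
  simp only [zero_add]
  linarith

lemma integrable_Gk'_mul (i j : ℕ) (τ s x : ℝ) :
    Integrable (fun y => Gk' i τ (x + y) * Gk' j s y) := by
  simp only [Gk'_eq]
  refine ((integrable_heatDeriv_mul (2 * i + 1) (2 * j + 1) τ s x).const_mul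
    (τ ^ i / i.factorial * (s ^ j / j.factorial))).congr (Eventually.of_forall fun y => ?_)
  ring

lemma integral_Gk'_mul (i j : ℕ) {τ s : ℝ} (hτ : 0 < τ) (hs : 0 < s) (x : ℝ) :
    ∫ y, Gk' i τ (x + y) * Gk' j s y =
      -(τ ^ i / i.factorial * (s ^ j / j.factorial) *
        heatDeriv (2 * (i + j + 1)) (τ + s) x) := by
  simp only [Gk'_eq]
  calc _ = ∫ y, (τ ^ i / i.factorial * (s ^ j / j.factorial)) *
        (heatDeriv (2 * i + 1) τ (x + y) * heatDeriv (2 * j + 1) s y) := by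
        congr 1; funext y; ring
    _ = _ := by
      rw [integral_const_mul, integral_heatDeriv_mul_heatDeriv _ _ hτ hs, pow_succ, pow_mul,
        show 2 * i + 1 + (2 * j + 1) = 2 * (i + j + 1) by ring]
      simp

lemma exists_integral_abs_Gk'_mul_le (i j : ℕ) : ∃ C : ℝ, 0 ≤ C ∧ ∀ τ s x : ℝ, 0 < τ → 0 < s →
    ∫ y, ‖Gk' i τ (x + y) * Gk' j s y‖ ≤
      C * ((√τ)⁻¹ * (√s)⁻¹ * heatK (2 * (τ + s)) x) := by
  obtain ⟨A, hA0, hA⟩ := abs_Gk'_le i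
  obtain ⟨B, hB0, hB⟩ := abs_Gk'_le j
  refine ⟨A * B, by positivity, fun τ s x hτ hs => ?_⟩
  have hint : Integrable (fun y => heatK (2 * τ) (x + y) * heatK (2 * s) y) := by
    simpa only [heatDeriv_zero] using integrable_heatDeriv_mul 0 0 (2 * τ) (2 * s) x
  calc _ ≤ ∫ y, (A * B * ((√τ)⁻¹ * (√s)⁻¹)) * (heatK (2 * τ) (x + y) * heatK (2 * s) y) := by
        refine integral_mono (integrable_Gk'_mul i j τ s x).norm (hint.const_mul _) fun y => ?_
        simp only [norm_mul, Real.norm_eq_abs]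
        refine (mul_le_mul (hA τ hτ _) (hB s hs y) (abs_nonneg _)
          ((abs_nonneg _).trans (hA τ hτ _))).trans (le_of_eq ?_)
        ring
    _ = _ := by
      rw [integral_const_mul, integral_heatK_mul_heatK (by positivity) (by positivity), mul_add]
      ring

lemma exists_heatK_le {t x : ℝ} (h : t ≠ 0 ∨ x ≠ 0) :
    ∃ C : ℝ, 0 ≤ C ∧ ∀ w : ℝ, 0 < w → |t| ≤ w → heatK (2 * w) x ≤ C * √w * (1 + w)⁻¹ := by
  obtain ⟨C, hC0, hC⟩ : ∃ C : ℝ, 0 ≤ C ∧ ∀ w : ℝ, 0 < w → |t| ≤ w →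
      Real.exp (-x ^ 2 / (4 * (2 * w))) ≤ C * w * (1 + w)⁻¹ := by
    rcases h with ht | hx
    · have ht' : 0 < |t| := abs_pos.2 ht
      refine ⟨1 + |t|⁻¹, by positivity, fun w hw htw => ?_⟩
      refine (Real.exp_le_one_iff.2 (div_nonpos_of_nonpos_of_nonneg
        (by nlinarith [sq_nonneg x]) (by positivity))).trans ?_
      rw [← div_eq_mul_inv, le_div_iff₀ (by positivity)]
      have : 1 ≤ |t|⁻¹ * w := by rwa [← div_eq_inv_mul, one_le_div ht']
      linarith
    · set a : ℝ := x ^ 2 / 8 with ha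
      have ha0 : 0 < a := by positivity
      refine ⟨1 + a⁻¹, by positivity, fun w hw _ => ?_⟩
      have h1 : -x ^ 2 / (4 * (2 * w)) = -(a / w) := by rw [ha]; field_simp; ring
      have h2 : 1 + a / w ≤ Real.exp (a / w) := by
        linarith [Real.add_one_le_exp (a / w)]
      rw [h1, Real.exp_neg]
      refine (inv_anti₀ (by positivity) h2).trans ?_
      rw [show (1 + a / w)⁻¹ = w / (w + a) by field_simp, ← div_eq_mul_inv,
        div_le_div_iff₀ (by positivity) (by positivity)]
      have : (1 + a⁻¹) * w * (w + a) - w * (1 + w) = w * (a + a⁻¹ * w) := by field_simp; ring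
      have : 0 ≤ w * (a + a⁻¹ * w) := by positivity
      linarith
  refine ⟨C, hC0, fun w hw htw => ?_⟩
  rw [heatK, if_pos (by positivity)]
  have h1 : (√(4 * π * (2 * w)))⁻¹ ≤ (√w)⁻¹ := by
    gcongr
    nlinarith [Real.pi_gt_three]
  calc _ ≤ (√w)⁻¹ * (C * w * (1 + w)⁻¹) := by gcongr; exact hC w hw htw
    _ = C * ((√w)⁻¹ * w) * (1 + w)⁻¹ := by ring
    _ = C * √w * (1 + w)⁻¹ := by
      congr 2
      rw [← div_eq_inv_mul, Real.div_sqrt]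

lemma integrableOn_inv_sqrt_mul_inv (a : ℝ) :
    IntegrableOn (fun s => (√(s - a))⁻¹ * (1 + (s - a))⁻¹) (Ioi a) := by
  refine integrableOn_Ioi_deriv_of_nonneg (g := fun s => 2 * Real.arctan (√(s - a)))
    (l := 2 * (π / 2)) ?_ (fun s hs => ?_) (fun s hs => ?_) ?_
  · exact Continuous.continuousWithinAt (by fun_prop)
  · have hs' : 0 < s - a := sub_pos.2 hs
    have h := ((((hasDerivAt_id s).sub_const a).sqrt hs'.ne').arctan).const_mul 2
    refine h.congr_deriv ?_
    simp only [id, Real.sq_sqrt hs'.le]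
    field_simp
  · have hs' : 0 < s - a := sub_pos.2 hs
    positivity
  · exact ((Real.tendsto_arctan_atTop.mono_right nhdsWithin_le_nhds).comp
      (Real.tendsto_sqrt_atTop.comp (tendsto_atTop_add_const_right _ (-a) tendsto_id))).const_mul 2

section Overlap

variable {t s : ℝ}

lemma mul_le_two_mul_of_max_lt (hs : max 0 (-t) < s) :
    (s - max 0 (-t)) * (t + 2 * s) ≤ 2 * (s * (t + s)) := by
  rcases le_total 0 (-t) with h | h
  · rw [max_eq_right h] at *
    nlinarith
  · rw [max_eq_left h] at *
    nlinarith

lemma inv_sqrt_mul_inv_sqrt_le (hs : max 0 (-t) < s) :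
    (√(t + s))⁻¹ * (√s)⁻¹ ≤ √2 * ((√(s - max 0 (-t)))⁻¹ * (√(t + 2 * s))⁻¹) := by
  have h0 : 0 < s := (le_max_left _ _).trans_lt hs
  have h1 : 0 < t + s := by linarith [(le_max_right 0 (-t)).trans_lt hs]
  have h2 : 0 < s - max 0 (-t) := sub_pos.2 hs
  have h3 : 0 < t + 2 * s := by linarith
  have h4 : √(s - max 0 (-t)) * √(t + 2 * s) ≤ √2 * (√s * √(t + s)) := by
    rw [← Real.sqrt_mul h2.le, ← Real.sqrt_mul h0.le, ← Real.sqrt_mul (by norm_num)]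
    exact Real.sqrt_le_sqrt (mul_le_two_mul_of_max_lt hs)
  rw [← mul_inv, ← mul_inv, ← div_eq_mul_inv, inv_eq_one_div,
    div_le_div_iff₀ (by positivity) (by positivity)]
  linarith

lemma pow_mul_pow_le (i j : ℕ) (hs : max 0 (-t) < s) :
    (t + s) ^ (i + 1) * s ^ (j + 1) ≤ (s - max 0 (-t)) * (t + 2 * s) ^ (i + j + 1) := by
  have h0 : 0 < s := (le_max_left _ _).trans_lt hs
  have h1 : 0 < t + s := by linarith [(le_max_right 0 (-t)).trans_lt hs]
  have h2 : t + s ≤ t + 2 * s := by linarith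
  have h3 : s ≤ t + 2 * s := by linarith
  have h4 : 0 < t + 2 * s := by linarith
  rcases le_total 0 (-t) with h | h
  · rw [max_eq_right h]
    calc _ = (t + s) * ((t + s) ^ i * s ^ (j + 1)) := by ring
      _ ≤ (t + s) * ((t + 2 * s) ^ i * (t + 2 * s) ^ (j + 1)) := by gcongr
      _ = _ := by ring
  · rw [max_eq_left h]
    calc _ = s * ((t + s) ^ (i + 1) * s ^ j) := by ring
      _ ≤ s * ((t + 2 * s) ^ (i + 1) * (t + 2 * s) ^ j) := by gcongr
      _ = _ := by ring

lemma abs_le_add_two_mul (hs : max 0 (-t) < s) : |t| ≤ t + 2 * s := by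
  have h0 : 0 < s := (le_max_left _ _).trans_lt hs
  have h1 : 0 < t + s := by linarith [(le_max_right 0 (-t)).trans_lt hs]
  exact abs_le.2 ⟨by linarith, by linarith⟩

lemma sub_max_le_add_two_mul (hs : max 0 (-t) < s) : s - max 0 (-t) ≤ t + 2 * s := by
  linarith [le_max_left 0 (-t), (le_max_right 0 (-t)).trans_lt hs]

end Overlap

lemma Gk'_mul_Gk'_of_le (i j : ℕ) {t s : ℝ} (hs : s ≤ max 0 (-t)) (z y : ℝ) :
    Gk' i (t + s) z * Gk' j s y = 0 := by
  rcases le_max_iff.1 hs with h | h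
  · rw [Gk'_of_nonpos j h, mul_zero]
  · rw [Gk'_of_nonpos i (by linarith), zero_mul]

lemma integrable_Gk'_mul_Gk' (i j : ℕ) {t x : ℝ} (h : t ≠ 0 ∨ x ≠ 0) :
    Integrable (fun p : ℝ × ℝ => Gk' i (t + p.1) (x + p.2) * Gk' j p.1 p.2) := by
  have hmeas : Measurable (fun p : ℝ × ℝ => Gk' i (t + p.1) (x + p.2) * Gk' j p.1 p.2) :=
    ((measurable_Gk' i).comp (by fun_prop : Measurable fun p : ℝ × ℝ => (t + p.1, x + p.2))).mul
      (measurable_Gk' j)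
  refine (integrable_prod_iff hmeas.aestronglyMeasurable).2
    ⟨Eventually.of_forall fun s => integrable_Gk'_mul i j (t + s) s x, ?_⟩
  obtain ⟨A, hA0, hA⟩ := exists_integral_abs_Gk'_mul_le i j
  obtain ⟨B, hB0, hB⟩ := exists_heatK_le h
  refine ((integrable_indicator_iff measurableSet_Ioi).2
    ((integrableOn_inv_sqrt_mul_inv (max 0 (-t))).const_mul (A * √2 * B))).mono'
    (hmeas.aestronglyMeasurable (μ := volume.prod volume)).norm.integral_prod_right'
    (Eventually.of_forall fun s => ?_)
  rw [Real.norm_of_nonneg (integral_nonneg fun y => norm_nonneg _)]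
  rcases le_or_gt s (max 0 (-t)) with hs | hs
  · simp [Gk'_mul_Gk'_of_le i j hs, hs.not_gt]
  · rw [indicator_of_mem (mem_Ioi.2 hs)]
    have h0 : 0 < s := (le_max_left _ _).trans_lt hs
    have h1 : 0 < t + s := by linarith [(le_max_right 0 (-t)).trans_lt hs]
    have h2 : 0 < s - max 0 (-t) := sub_pos.2 hs
    have h3 : 0 < t + 2 * s := by linarith
    have h4 := hB _ h3 (abs_le_add_two_mul hs)
    have h5 := sub_max_le_add_two_mul hs
    refine (hA (t + s) s x h1 h0).trans ?_
    rw [show t + s + s = t + 2 * s by ring]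
    calc _ ≤ A * (√2 * ((√(s - max 0 (-t)))⁻¹ * (√(t + 2 * s))⁻¹) *
          (B * √(t + 2 * s) * (1 + (t + 2 * s))⁻¹)) := by
          have := inv_sqrt_mul_inv_sqrt_le hs
          have := heatK_nonneg (2 * (t + 2 * s)) x
          gcongr
      _ = A * √2 * B * ((√(s - max 0 (-t)))⁻¹ * (1 + (t + 2 * s))⁻¹) := by
          have h6 : √(t + 2 * s) ≠ 0 := by positivity
          generalize √(t + 2 * s) = q at h6 ⊢
          field_simp
      _ ≤ _ := by gcongr

/-- The density in time of `Dker` after the spatial integration has been carried out. -/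
noncomputable def DkerDensity (i j : ℕ) (t x s : ℝ) : ℝ :=
  (t + s) ^ i / i.factorial * (s ^ j / j.factorial) * heatDeriv (2 * (i + j + 1)) (t + 2 * s) x

lemma integral_Gk'_mul_eq_indicator (i j : ℕ) (t x s : ℝ) :
    ∫ y, Gk' i (t + s) (x + y) * Gk' j s y =
      (Ioi (max 0 (-t))).indicator (fun s => -DkerDensity i j t x s) s := by
  rcases le_or_gt s (max 0 (-t)) with hs | hs
  · simp [Gk'_mul_Gk'_of_le i j hs, hs.not_gt]
  · have h0 : 0 < s := (le_max_left _ _).trans_lt hs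
    have h1 : 0 < t + s := by linarith [(le_max_right 0 (-t)).trans_lt hs]
    rw [indicator_of_mem (mem_Ioi.2 hs), integral_Gk'_mul i j h1 h0, DkerDensity, two_mul s,
      add_assoc t]

lemma integrableOn_DkerDensity (i j : ℕ) {t x : ℝ} (h : t ≠ 0 ∨ x ≠ 0) :
    IntegrableOn (DkerDensity i j t x) (Ioi (max 0 (-t))) := by
  have := (integrable_Gk'_mul_Gk' i j h).integral_prod_left
  simp_rw [integral_Gk'_mul_eq_indicator] at this
  simpa using ((integrable_indicator_iff measurableSet_Ioi).1 this).neg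

lemma Dker_eq_setIntegral (i j : ℕ) {t x : ℝ} (h : t ≠ 0 ∨ x ≠ 0) :
    Dker i j t x = -∫ s in Ioi (max 0 (-t)), DkerDensity i j t x s := by
  rw [Dker_eq_integral, Measure.volume_eq_prod, integral_prod _ (integrable_Gk'_mul_Gk' i j h)]
  simp_rw [integral_Gk'_mul_eq_indicator]
  rw [integral_indicator measurableSet_Ioi, integral_neg]

/-- A primitive of the combination of densities occurring in the recursion for `Dker`. -/
noncomputable def DkerPrimitive (i j : ℕ) (t x s : ℝ) : ℝ :=
  (t + s) ^ (i + 1) / (i + 1).factorial * (s ^ (j + 1) / (j + 1).factorial) *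
    heatDeriv (2 * (i + j + 2)) (t + 2 * s) x

lemma hasDerivAt_pow_div_factorial (n : ℕ) (s : ℝ) :
    HasDerivAt (fun s : ℝ => s ^ (n + 1) / (n + 1).factorial) (s ^ n / n.factorial) s := by
  refine ((hasDerivAt_pow (n + 1) s).div_const _).congr_deriv ?_
  rw [Nat.factorial_succ]
  rw [Nat.add_sub_cancel]
  push_cast
  field_simp

lemma hasDerivAt_DkerPrimitive (i j : ℕ) {t s : ℝ} (x : ℝ) (hs : 0 < t + 2 * s) :
    HasDerivAt (DkerPrimitive i j t x)
      (DkerDensity i (j + 1) t x s + DkerDensity (i + 1) j t x s +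
        2 * DkerDensity (i + 1) (j + 1) t x s) s := by
  have h1 : HasDerivAt (fun s : ℝ => t + 2 * s) 2 s := by
    simpa using ((hasDerivAt_id s).const_mul 2).const_add t
  have h2 := (hasDerivAt_heatDeriv_time (2 * (i + j + 2)) hs x).comp s h1
  have h3 := (hasDerivAt_pow_div_factorial i (t + s)).comp_const_add t s
  have h4 := (h3.fun_mul (hasDerivAt_pow_div_factorial j s)).fun_mul h2
  refine h4.congr_deriv ?_
  simp only [DkerDensity, Function.comp_apply]
  rw [show i + (j + 1) + 1 = i + j + 2 by ring, show i + 1 + j + 1 = i + j + 2 by ring,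
    show 2 * (i + 1 + (j + 1) + 1) = 2 * (i + j + 2) + 2 by ring]
  ring

lemma DkerPrimitive_max (i j : ℕ) (t x : ℝ) : DkerPrimitive i j t x (max 0 (-t)) = 0 := by
  rcases le_total 0 (-t) with h | h
  · simp [DkerPrimitive, max_eq_right h]
  · simp [DkerPrimitive, max_eq_left h]

lemma exists_abs_DkerPrimitive_le (i j : ℕ) {t x : ℝ} (h : t ≠ 0 ∨ x ≠ 0) :
    ∃ C : ℝ, 0 ≤ C ∧ ∀ s, max 0 (-t) < s →
      |DkerPrimitive i j t x s| ≤ C * √(s - max 0 (-t)) * (1 + (s - max 0 (-t)))⁻¹ := by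
  obtain ⟨A, hA0, hA⟩ := abs_heatDeriv_le (2 * (i + j + 2))
  obtain ⟨B, hB0, hB⟩ := exists_heatK_le h
  refine ⟨A * B, by positivity, fun s hs => ?_⟩
  have h0 : 0 < s := (le_max_left _ _).trans_lt hs
  have h1 : 0 < t + s := by linarith [(le_max_right 0 (-t)).trans_lt hs]
  have h2 : 0 < s - max 0 (-t) := sub_pos.2 hs
  have h3 : 0 < t + 2 * s := by linarith
  have h4 := hB _ h3 (abs_le_add_two_mul hs)
  have h5 := sub_max_le_add_two_mul hs
  have h6 := pow_mul_pow_le i j hs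
  have hfac : ∀ n : ℕ, (1 : ℝ) ≤ n.factorial := fun n => by exact_mod_cast n.factorial_pos
  rw [DkerPrimitive, abs_mul, abs_of_nonneg (by positivity)]
  have h7 : (t + s) ^ (i + 1) / (i + 1).factorial * (s ^ (j + 1) / (j + 1).factorial) ≤
      (t + s) ^ (i + 1) * s ^ (j + 1) := by
    gcongr
    · exact div_le_self (by positivity) (hfac _)
    · exact div_le_self (by positivity) (hfac _)
  generalize hr : s - max 0 (-t) = r at *
  generalize hw : t + 2 * s = w at *
  have h8 : (√r)⁻¹ ≥ (√w)⁻¹ := by gcongr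
  calc _ ≤ r * w ^ (i + j + 1) *
        (A * (√w)⁻¹ ^ (2 * (i + j + 2)) * (B * √w * (1 + w)⁻¹)) := by
        have := (hA w h3 x).trans (mul_le_mul_of_nonneg_left h4 (by positivity))
        exact mul_le_mul (h7.trans h6) this (abs_nonneg _) (by positivity)
    _ = A * B * (r * (√w)⁻¹) * (1 + w)⁻¹ := by
        have : √w * w⁻¹ = (√w)⁻¹ := by
          rw [← div_eq_mul_inv, Real.sqrt_div_self]
        rw [pow_mul, inv_pow (√w) 2, Real.sq_sqrt h3.le, ← this, inv_pow]
        field_simp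
        ring
    _ ≤ A * B * (r * (√r)⁻¹) * (1 + r)⁻¹ := by gcongr
    _ = _ := by rw [← div_eq_mul_inv r, Real.div_sqrt]

lemma integral_deriv_DkerPrimitive (i j : ℕ) {t x : ℝ} (h : t ≠ 0 ∨ x ≠ 0) :
    ∫ s in Ioi (max 0 (-t)), (DkerDensity i (j + 1) t x s + DkerDensity (i + 1) j t x s +
      2 * DkerDensity (i + 1) (j + 1) t x s) = 0 := by
  obtain ⟨C, hC0, hC⟩ := exists_abs_DkerPrimitive_le i j h
  have hzero := DkerPrimitive_max i j t x
  have key := integral_Ioi_of_hasDerivAt_of_tendsto (a := max 0 (-t)) (m := 0)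
    (f := DkerPrimitive i j t x) ?_ (fun s hs => hasDerivAt_DkerPrimitive i j x ?_)
    (((integrableOn_DkerDensity i (j + 1) h).add (integrableOn_DkerDensity (i + 1) j h)).add
      ((integrableOn_DkerDensity (i + 1) (j + 1) h).const_mul 2)) ?_
  · rw [hzero, sub_zero] at key
    exact key
  · rw [ContinuousWithinAt, hzero]
    have hlim : Tendsto (fun s => C * √(s - max 0 (-t))) (𝓝[≥] (max 0 (-t))) (𝓝 0) := by
      have : Continuous (fun s => C * √(s - max 0 (-t))) := by fun_prop
      simpa using (this.tendsto (max 0 (-t))).mono_left nhdsWithin_le_nhds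
    refine squeeze_zero_norm' (eventually_mem_nhdsWithin.mono fun s hs => ?_) hlim
    rcases (mem_Ici.1 hs).eq_or_lt with rfl | hs'
    · rw [hzero]; simp
    · have hr : 0 < s - max 0 (-t) := sub_pos.2 hs'
      refine (hC s hs').trans (mul_le_of_le_one_right (by positivity) ?_)
      exact inv_le_one_of_one_le₀ (by linarith)
  · linarith [le_max_left 0 (-t), (le_max_right 0 (-t)), mem_Ioi.1 hs]
  · have hlim : Tendsto (fun s => C * (√(s - max 0 (-t)))⁻¹) atTop (𝓝 0) := by
      have := (tendsto_inv_atTop_zero.comp (Real.tendsto_sqrt_atTop.comp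
        (tendsto_atTop_add_const_right _ (-max 0 (-t)) tendsto_id))).const_mul C
      simpa [sub_eq_add_neg] using this
    refine squeeze_zero_norm' ((eventually_gt_atTop (max 0 (-t))).mono fun s hs => ?_) hlim
    have hr : 0 < s - max 0 (-t) := sub_pos.2 hs
    refine (hC s hs).trans ?_
    rw [mul_assoc]
    refine mul_le_mul_of_nonneg_left ?_ hC0
    rw [← div_eq_mul_inv, inv_eq_one_div, div_le_div_iff₀ (by positivity) (by positivity),
      Real.mul_self_sqrt hr.le]
    linarith

/-- For `i, j ≥ 1`, the recursion `D_{i,j} = -(1/2)(D_{i-1,j} + D_{i,j-1})` holds. -/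
theorem stmt_9 (i j : ℕ) (hi : 1 ≤ i) (hj : 1 ≤ j) (t x : ℝ) :
    Dker i j t x = -(1 / 2) * (Dker (i - 1) j t x + Dker i (j - 1) t x) := by
  obtain ⟨i, rfl⟩ := Nat.exists_eq_add_of_le' hi
  obtain ⟨j, rfl⟩ := Nat.exists_eq_add_of_le' hj
  simp only [Nat.add_sub_cancel]
  by_cases h : t ≠ 0 ∨ x ≠ 0
  · have key := integral_deriv_DkerPrimitive i j h
    have h1 := integrableOn_DkerDensity i (j + 1) h
    have h2 := integrableOn_DkerDensity (i + 1) j h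
    have h3 := integrableOn_DkerDensity (i + 1) (j + 1) h
    rw [integral_add (h1.fun_add h2) (h3.const_mul 2), integral_add h1 h2, integral_const_mul] at key
    rw [Dker_eq_setIntegral _ _ h, Dker_eq_setIntegral _ _ h, Dker_eq_setIntegral _ _ h]
    linarith
  · push Not at h
    obtain ⟨rfl, rfl⟩ := h
    simp [Dker_zero_zero]
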